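/- If Ψ satisfies the RIP condition δ_{3S} + a(S)·δ_{4S} < a(S) − 1 with a(S) := ((√(3S)−1)/(√S+1))² > 1, and u = Ψc* + z with ‖z‖₂ ≤ ε for an S-sparse c*, then any minimizer c̄ of ‖c‖₁ − ‖c‖₂ subject to ‖u − Ψc‖₂ ≤ ε satisfies ‖c* − c̄‖₂ ≤ 2ε√(1 + a(S)) / (√(a(S)(1 − δ_{4S})) − √(1 + δ_{3S})). -/

import Mathlib

open Finset

noncomputable def coherence {M K : ℕ} (Ψ : Matrix (Fin M) (Fin K) ℝ) : ℝ :=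
  sSup {x : ℝ | ∃ i j : Fin K, i ≠ j ∧
    x = |∑ m, Ψ m i * Ψ m j| /
      (Real.sqrt (∑ m, (Ψ m i)^2) * Real.sqrt (∑ m, (Ψ m j)^2))}

noncomputable def l0 {K : ℕ} (c : Fin K → ℝ) : ℕ := (Finset.univ.filter fun j => c j ≠ 0).card

noncomputable def l1 {K : ℕ} (c : Fin K → ℝ) : ℝ := ∑ j, |c j|

noncomputable def l2 {n : ℕ} (c : Fin n → ℝ) : ℝ := Real.sqrt (∑ j, (c j)^2)

noncomputable def ripConst {M K : ℕ} (Ψ : Matrix (Fin M) (Fin K) ℝ) (S : ℕ) : ℝ :=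
  sInf {δ : ℝ | 0 ≤ δ ∧ ∀ c : Fin K → ℝ, l0 c ≤ S →
    (1 - δ) * (l2 c)^2 ≤ (l2 (Ψ.mulVec c))^2 ∧
    (l2 (Ψ.mulVec c))^2 ≤ (1 + δ) * (l2 c)^2}

noncomputable def aFun (S : ℝ) : ℝ := ((Real.sqrt (3 * S) - 1) / (Real.sqrt S + 1))^2

lemma sqle {a b : ℝ} (h : a^2 ≤ b^2) (hb : 0 ≤ b) : a ≤ b := (le_abs_self a).trans (abs_le_of_sq_le_sq h hb)

lemma l2_eq_norm {n : ℕ} (c : Fin n → ℝ) : l2 c = ‖(WithLp.toLp 2 c : EuclideanSpace ℝ (Fin n))‖ := by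
  rw [EuclideanSpace.norm_eq]; simp [l2]

lemma l2_add_le {n : ℕ} (c d : Fin n → ℝ) : l2 (c + d) ≤ l2 c + l2 d := by
  simp only [l2_eq_norm, WithLp.toLp_add]; exact norm_add_le _ _

lemma l2_neg {n : ℕ} (c : Fin n → ℝ) : l2 (-c) = l2 c := by simp [l2]

lemma l2_nonneg {n : ℕ} (c : Fin n → ℝ) : 0 ≤ l2 c := Real.sqrt_nonneg _

lemma l2_sq {n : ℕ} (c : Fin n → ℝ) : (l2 c)^2 = ∑ j, (c j)^2 :=
  Real.sq_sqrt (Finset.sum_nonneg fun _ _ => sq_nonneg _)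

noncomputable def res {K : ℕ} (U : Finset (Fin K)) (v : Fin K → ℝ) : Fin K → ℝ :=
  fun j => if j ∈ U then v j else 0

lemma l2_res_sq {K : ℕ} (U : Finset (Fin K)) (v : Fin K → ℝ) :
    (l2 (res U v))^2 = ∑ j ∈ U, (v j)^2 := by
  rw [l2_sq]; simp [res, ite_pow, Finset.sum_ite_mem]

lemma l0_res {K : ℕ} (U : Finset (Fin K)) (v : Fin K → ℝ) : l0 (res U v) ≤ U.card := by
  apply Finset.card_le_card
  intro j hj
  simp [res] at hj
  exact hj.1

lemma res_split {K : ℕ} (U T : Finset (Fin K)) (h : T ⊆ U) (v : Fin K → ℝ) :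
    res U v = res T v + res (U \ T) v := by
  funext j
  have := @h j
  simp only [res, Pi.add_apply, Finset.mem_sdiff]
  by_cases h1 : j ∈ T <;> by_cases h2 : j ∈ U <;> simp_all

lemma res_le_l1 {K : ℕ} (U : Finset (Fin K)) (v : Fin K → ℝ) :
    l2 (res U v) ≤ ∑ j ∈ U, |v j| := by
  refine sqle ?_ (by positivity)
  rw [l2_res_sq]
  have := Finset.sum_sq_le_sq_sum_of_nonneg (s := U) (f := fun j => |v j|) (fun _ _ => abs_nonneg _)
  simpa only [sq_abs] using this

lemma rip_spec {M K : ℕ} (Ψ : Matrix (Fin M) (Fin K) ℝ) (S : ℕ) :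
    0 ≤ ripConst Ψ S ∧ ∀ c : Fin K → ℝ, l0 c ≤ S →
    (1 - ripConst Ψ S) * (l2 c)^2 ≤ (l2 (Ψ.mulVec c))^2 ∧
    (l2 (Ψ.mulVec c))^2 ≤ (1 + ripConst Ψ S) * (l2 c)^2 := by
  set A := {δ : ℝ | 0 ≤ δ ∧ ∀ c : Fin K → ℝ, l0 c ≤ S →
    (1 - δ) * (l2 c)^2 ≤ (l2 (Ψ.mulVec c))^2 ∧
    (l2 (Ψ.mulVec c))^2 ≤ (1 + δ) * (l2 c)^2} with hA
  have hne : A.Nonempty := by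
    have hG : 0 ≤ ∑ m, ∑ j, (Ψ m j)^2 := by positivity
    refine ⟨1 + ∑ m, ∑ j, (Ψ m j)^2, by positivity, fun c _ => ⟨?_, ?_⟩⟩
    · nlinarith [sq_nonneg (l2 c), sq_nonneg (l2 (Ψ.mulVec c)), mul_nonneg hG (sq_nonneg (l2 c))]
    · have : (l2 (Ψ.mulVec c))^2 ≤ (∑ m, ∑ j, (Ψ m j)^2) * (l2 c)^2 := by
        rw [l2_sq, l2_sq, Finset.sum_mul]
        apply Finset.sum_le_sum
        intro m _
        simp only [Matrix.mulVec, dotProduct]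
        exact Finset.sum_mul_sq_le_sq_mul_sq _ _ _
      nlinarith [sq_nonneg (l2 c)]
  have hbd : BddBelow A := ⟨0, fun x hx => hx.1⟩
  have hcl : IsClosed A := by
    have : A = Set.Ici 0 ∩ ⋂ c : Fin K → ℝ, ⋂ _ : l0 c ≤ S,
        ({δ : ℝ | (1 - δ) * (l2 c)^2 ≤ (l2 (Ψ.mulVec c))^2} ∩
        {δ : ℝ | (l2 (Ψ.mulVec c))^2 ≤ (1 + δ) * (l2 c)^2}) := by
      ext δ; simp [hA]
    rw [this]
    refine isClosed_Ici.inter (isClosed_iInter fun c => isClosed_iInter fun _ => IsClosed.inter ?_ ?_)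
    · exact isClosed_le (by fun_prop) (by fun_prop)
    · exact isClosed_le (by fun_prop) (by fun_prop)
  exact hcl.csInf_mem hne hbd

lemma exists_top {K : ℕ} (v : Fin K → ℝ) (U : Finset (Fin K)) (n : ℕ) (hn : n ≤ U.card) :
    ∃ T ⊆ U, T.card = n ∧ ∃ B : ℝ, 0 ≤ B ∧ (∀ t ∈ T, B ≤ |v t|) ∧ ∀ t ∈ U \ T, |v t| ≤ B := by
  induction n with
  | zero =>
    refine ⟨∅, by simp, by simp, ∑ t ∈ U, |v t|, by positivity, by simp, ?_⟩
    intro t ht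
    exact Finset.single_le_sum (f := fun t => |v t|) (fun _ _ => abs_nonneg _) (by simpa using ht)
  | succ n ih =>
    obtain ⟨T, hTU, hc, B, hB, h1, h2⟩ := ih (by omega)
    have hne : (U \ T).Nonempty := by
      rw [← Finset.card_pos, Finset.card_sdiff_of_subset hTU]; omega
    obtain ⟨m, hm, hmax⟩ := Finset.exists_max_image (U \ T) (fun t => |v t|) hne
    have hm' := Finset.mem_sdiff.1 hm
    refine ⟨insert m T, ?_, ?_, |v m|, abs_nonneg _, ?_, ?_⟩
    · exact Finset.insert_subset hm'.1 hTU
    · rw [Finset.card_insert_of_notMem hm'.2, hc]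
    · intro t ht
      rcases Finset.mem_insert.1 ht with rfl | ht
      · exact le_rfl
      · exact (h2 m hm).trans (h1 t ht)
    · intro t ht
      apply hmax
      simp only [Finset.mem_sdiff, Finset.mem_insert, not_or] at ht ⊢
      exact ⟨ht.1, ht.2.2⟩

lemma res_le_bound {K : ℕ} (v : Fin K → ℝ) (T : Finset (Fin K)) (q B : ℝ) (hq : 0 ≤ q)
    (hc : (T.card : ℝ) ≤ q^2) (hB : 0 ≤ B) (h : ∀ t ∈ T, |v t| ≤ B) : l2 (res T v) ≤ q * B := by
  refine sqle ?_ (by positivity)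
  rw [l2_res_sq]
  calc ∑ j ∈ T, (v j)^2 ≤ ∑ j ∈ T, B^2 := Finset.sum_le_sum fun j hj => sq_le_sq' (by linarith [neg_abs_le (v j), h j hj]) (by linarith [le_abs_self (v j), h j hj])
    _ = T.card * B^2 := by simp
    _ ≤ q^2 * B^2 := by gcongr
    _ = _ := by ring

lemma key_block {K : ℕ} (v : Fin K → ℝ) (T : Finset (Fin K)) (q B : ℝ) (hq : 0 ≤ q)
    (hc : (T.card : ℝ) = q^2) (hB : 0 ≤ B) (h : ∀ t ∈ T, B ≤ |v t|) :
    (q - 1) * q * B ≤ ∑ j ∈ T, |v j| - l2 (res T v) := by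
  have e1 : l2 (res T v) = l2 (res T (fun j => |v j|)) := by
    rw [← sq_eq_sq₀ (l2_nonneg _) (l2_nonneg _), l2_res_sq, l2_res_sq]; simp
  have e2 : res T (fun j => |v j|) = res T (fun _ => B) + res T (fun j => |v j| - B) := by
    funext j; simp only [res, Pi.add_apply]; split_ifs <;> ring
  have e3 := l2_add_le (res T (fun _ => B)) (res T (fun j => |v j| - B))
  rw [← e2, ← e1] at e3
  have e4 := res_le_bound (fun _ => B) T q B hq hc.le hB (by simp [abs_of_nonneg hB])
  have e5 := res_le_l1 T (fun j => |v j| - B)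
  have e6 : ∑ j ∈ T, |(|v j| - B)| = ∑ j ∈ T, |v j| - q^2 * B := by
    rw [Finset.sum_congr rfl (fun j hj => abs_of_nonneg (sub_nonneg.2 (h j hj)))]
    simp [hc]
  nlinarith

lemma blocks {M K : ℕ} (Ψ : Matrix (Fin M) (Fin K) ℝ) (v : Fin K → ℝ) (n : ℕ) (q g : ℝ)
    (hq : 1 < q) (hn : (n : ℝ) = q^2)
    (hg : ∀ c : Fin K → ℝ, l0 c ≤ n → l2 (Ψ.mulVec c) ≤ g * l2 c) (N : ℕ) :
    ∀ (U : Finset (Fin K)) (B : ℝ), U.card ≤ N → 0 ≤ B → (∀ t ∈ U, |v t| ≤ B) →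
    ∃ X : ℝ, l2 (res U v) ≤ X ∧ l2 (Ψ.mulVec (res U v)) ≤ g * X ∧
      q * X ≤ (q - 1) * q * B + ∑ j ∈ U, |v j| := by
  have hnpos : 0 < n := by
    have : (0:ℝ) < n := by rw [hn]; positivity
    exact_mod_cast this
  induction N with
  | zero =>
    intro U B hU hB h
    have : U = ∅ := by simpa using hU
    subst this
    have h0 : l2 (res ∅ v) = 0 := by simp [l2, res]
    refine ⟨0, h0.le, ?_, ?_⟩
    · have := hg (res ∅ v) ((l0_res _ _).trans (by simp)); rwa [h0] at this
    · simp only [mul_zero, Finset.sum_empty, add_zero]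
      have : 0 < q - 1 := by linarith
      positivity
  | succ N ih =>
    intro U B hU hB h
    by_cases hc : U.card ≤ n
    · refine ⟨l2 (res U v), le_rfl, hg _ ((l0_res _ _).trans hc), ?_⟩
      have h1 := res_le_bound v U q B (by linarith) (by rw [← hn]; exact_mod_cast hc) hB h
      have h2 := res_le_l1 U v
      nlinarith
    · obtain ⟨T, hTU, hTc, B', hB', h1, h2⟩ := exists_top v U n (by omega)
      have hcd : (U \ T).card ≤ N := by rw [Finset.card_sdiff_of_subset hTU]; omega
      obtain ⟨X, hX1, hX2, hX3⟩ := ih (U \ T) B' hcd hB' h2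
      have hk := key_block v T q B' (by linarith) (by rw [hTc, hn]) hB' h1
      have hb := res_le_bound v T q B (by linarith) (by rw [hTc, hn]) hB (fun t ht => h t (hTU ht))
      have hs := Finset.sum_sdiff (f := fun j => |v j|) hTU
      refine ⟨l2 (res T v) + X, ?_, ?_, ?_⟩
      · rw [res_split U T hTU]; exact (l2_add_le _ _).trans (by linarith)
      · rw [res_split U T hTU, Matrix.mulVec_add]
        have := hg (res T v) ((l0_res _ _).trans hTc.le)
        exact (l2_add_le _ _).trans (by linarith)
      · nlinarith

lemma tail {M K : ℕ} (Ψ : Matrix (Fin M) (Fin K) ℝ) (v : Fin K → ℝ) (n : ℕ) (q g : ℝ)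
    (hq : 1 < q) (hn : (n : ℝ) = q^2)
    (hg : ∀ c : Fin K → ℝ, l0 c ≤ n → l2 (Ψ.mulVec c) ≤ g * l2 c) (U : Finset (Fin K)) :
    ∃ T ⊆ U, T.card ≤ n ∧ ∃ X : ℝ, l2 (res (U \ T) v) ≤ X ∧
      l2 (Ψ.mulVec (res (U \ T) v)) ≤ g * X ∧
      (q - 1) * X ≤ ∑ j ∈ U, |v j| - l2 (res U v) := by
  by_cases hc : U.card ≤ n
  · have h0 : l2 (res ∅ v) = 0 := by simp [l2, res]
    refine ⟨U, le_rfl, hc, 0, ?_, ?_, ?_⟩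
    · simp [h0]
    · have := hg (res ∅ v) ((l0_res _ _).trans (by simp))
      rw [h0] at this
      simpa using this
    · linarith [res_le_l1 U v]
  · obtain ⟨T, hTU, hTc, B', hB', h1, h2⟩ := exists_top v U n (by omega)
    obtain ⟨X, hX1, hX2, hX3⟩ := blocks Ψ v n q g hq hn hg _ (U \ T) B' le_rfl hB' h2
    have hk := key_block v T q B' (by linarith) (by rw [hTc, hn]) hB' h1
    have hs := Finset.sum_sdiff (f := fun j => |v j|) hTU
    refine ⟨T, hTU, hTc.le, X, hX1, hX2, ?_⟩
    have := l2_add_le (res T v) (res (U \ T) v)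
    rw [← res_split U T hTU] at this
    nlinarith

lemma res_l1_le {K : ℕ} (v : Fin K → ℝ) (T : Finset (Fin K)) (s : ℝ) (hs : 0 ≤ s)
    (hc : (T.card : ℝ) ≤ s^2) : ∑ j ∈ T, |v j| ≤ s * l2 (res T v) := by
  refine sqle ?_ (mul_nonneg hs (l2_nonneg _))
  rw [mul_pow, l2_res_sq]
  have := sq_sum_le_card_mul_sum_sq (s := T) (f := fun j => |v j|)
  simp only [sq_abs] at this
  exact this.trans (by gcongr)

lemma cone {K : ℕ} (x y : Fin K → ℝ) (T : Finset (Fin K)) (hT : ∀ j ∉ T, x j = 0)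
    (h : l1 y - l2 y ≤ l1 x - l2 x) :
    ∑ j ∈ Tᶜ, |(x - y) j| ≤ ∑ j ∈ T, |(x - y) j| + l2 (x - y) := by
  have h1 : l2 y ≤ l2 x + l2 (x - y) := by
    have := l2_add_le x (-(x - y)); rw [l2_neg] at this; simpa using this
  have h2 : l1 x = ∑ j ∈ T, |x j| := by
    rw [l1, ← Finset.sum_add_sum_compl T, Finset.sum_eq_zero (s := Tᶜ), add_zero]
    intro j hj; simp [hT j (by simpa using hj)]
  have h3 : l1 y = ∑ j ∈ T, |y j| + ∑ j ∈ Tᶜ, |(x - y) j| := by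
    rw [l1, ← Finset.sum_add_sum_compl T]
    congr 1
    apply Finset.sum_congr rfl
    intro j hj; simp [hT j (by simpa using hj)]
  have h4 : ∑ j ∈ T, |x j| ≤ ∑ j ∈ T, |y j| + ∑ j ∈ T, |(x - y) j| := by
    rw [← Finset.sum_add_distrib]
    apply Finset.sum_le_sum
    intro j _
    have := abs_add_le (y j) (x j - y j)
    simpa using this
  linarith

set_option maxHeartbeats 1000000 in
theorem l1_minus_l2_recovery {M K : ℕ} (Ψ : Matrix (Fin M) (Fin K) ℝ)
    (S : ℕ) (ha : aFun (S : ℝ) > 1)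
    (hrip : ripConst Ψ (3 * S) + aFun (S : ℝ) * ripConst Ψ (4 * S) < aFun (S : ℝ) - 1)
    (u z : Fin M → ℝ) (cstar : Fin K → ℝ)
    (hsparse : l0 cstar ≤ S)
    (hu : u = Ψ.mulVec cstar + z) (ε : ℝ) (hz : l2 z ≤ ε)
    (cbar : Fin K → ℝ)
    (hfeas : l2 (u - Ψ.mulVec cbar) ≤ ε)
    (hmin : ∀ c : Fin K → ℝ, l2 (u - Ψ.mulVec c) ≤ ε →
      l1 cbar - l2 cbar ≤ l1 c - l2 c) :
    l2 (cstar - cbar) ≤ 2 * ε * Real.sqrt (1 + aFun (S : ℝ)) /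
      (Real.sqrt (aFun (S : ℝ) * (1 - ripConst Ψ (4 * S))) -
        Real.sqrt (1 + ripConst Ψ (3 * S))) := by
  obtain ⟨h3n, h3⟩ := rip_spec Ψ (3 * S)
  obtain ⟨h4n, h4⟩ := rip_spec Ψ (4 * S)
  set δ3 := ripConst Ψ (3 * S)
  set δ4 := ripConst Ψ (4 * S)
  set s := Real.sqrt (S : ℝ) with hs
  set q := Real.sqrt (3 * (S : ℝ)) with hq
  have hs0 : 0 ≤ s := Real.sqrt_nonneg _
  have hq0 : 0 ≤ q := Real.sqrt_nonneg _
  have hs2 : s^2 = S := Real.sq_sqrt (by positivity)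
  have hq2 : q^2 = 3 * S := Real.sq_sqrt (by positivity)
  set a := aFun (S : ℝ) with haf
  have haeq : a = ((q - 1) / (s + 1))^2 := rfl
  have hq1 : s + 1 < q - 1 := by
    by_contra hcon
    have : a ≤ 1 := by
      rw [haeq, div_pow, div_le_one (by positivity)]
      apply sq_le_sq' <;> linarith
    linarith
  set r := (q - 1) / (s + 1) with hr
  have hr1 : 1 < r := by rw [hr, one_lt_div (by positivity)]; exact hq1
  have hrm : r * (s + 1) = q - 1 := by rw [hr]; field_simp
  set v := cstar - cbar with hv
  set T := Finset.univ.filter fun j => cstar j ≠ 0 with hT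
  have hTc : T.card ≤ S := hsparse
  have hcone := cone cstar cbar T (by intro j hj; simpa [hT] using hj)
    (hmin cstar (by rw [hu]; simpa using hz))
  rw [← hv] at hcone
  -- tail
  set g := Real.sqrt (1 + δ3) with hgdef
  have hg2 : g^2 = 1 + δ3 := Real.sq_sqrt (by linarith)
  have hg0 : 0 ≤ g := Real.sqrt_nonneg _
  have hg : ∀ c : Fin K → ℝ, l0 c ≤ 3 * S → l2 (Ψ.mulVec c) ≤ g * l2 c := by
    intro c hc
    refine sqle ?_ (mul_nonneg hg0 (l2_nonneg _))
    rw [mul_pow, hg2]; exact (h3 c hc).2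
  obtain ⟨T1, hT1, hT1c, X, hX1, hX2, hX3⟩ := tail Ψ v (3 * S) q g (by linarith)
    (by rw [hq2]; push_cast; ring) hg Tᶜ
  have hδ4 : 0 < 1 - δ4 := by nlinarith
  set f := Real.sqrt (1 - δ4) with hfdef
  have hf2 : f^2 = 1 - δ4 := Real.sq_sqrt hδ4.le
  have hf0 : 0 ≤ f := Real.sqrt_nonneg _
  have hD : Real.sqrt (a * (1 - δ4)) = r * f := by
    rw [haeq, Real.sqrt_mul (by positivity), Real.sqrt_sq (by linarith)]
  have hDpos : 0 < r * f - g := by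
    rw [sub_pos]
    apply lt_of_pow_lt_pow_left₀ 2 (by positivity)
    rw [mul_pow, hg2, hf2, ← haeq]; linarith
  -- T01
  set P := (Tᶜ \ T1)ᶜ with hP
  have hPc : P.card ≤ 4 * S := by
    have : P ⊆ T ∪ T1 := by
      intro j hj; simp [hP] at hj ⊢; tauto
    have := (Finset.card_le_card this).trans (Finset.card_union_le _ _)
    omega
  have hTP : T ⊆ P := by intro j hj; simp [hP]; tauto
  have hvsplit : v = res P v + res (Tᶜ \ T1) v := by
    funext j; simp only [res, hP, Pi.add_apply, Finset.mem_compl]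
    by_cases h : j ∈ Tᶜ \ T1 <;> simp [h]
  set Y := l2 (res P v) with hY
  have hY0 : 0 ≤ Y := l2_nonneg _
  have hTY : l2 (res T v) ≤ Y := by
    refine sqle ?_ hY0
    rw [l2_res_sq, hY, l2_res_sq]
    exact Finset.sum_le_sum_of_subset_of_nonneg hTP (fun _ _ _ => sq_nonneg _)
  have hX0 : 0 ≤ X := (l2_nonneg _).trans hX1
  have hl1 := res_l1_le v T s hs0 (by rw [hs2]; exact_mod_cast hTc)
  have hvT : l2 v ≤ l2 (res T v) + l2 (res Tᶜ v) := by
    have : v = res T v + res Tᶜ v := by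
      funext j; simp only [res, Pi.add_apply, Finset.mem_compl]
      by_cases h : j ∈ T <;> simp [h]
    conv_lhs => rw [this]
    exact l2_add_le _ _
  have hXY : r * X ≤ Y := by
    have : (s + 1) * (r * X) ≤ (s + 1) * Y := by
      have e : (s + 1) * (r * X) = (q - 1) * X := by rw [← hrm]; ring
      nlinarith
    exact le_of_mul_le_mul_left this (by positivity)
  have hlow : f * Y ≤ l2 (Ψ.mulVec (res P v)) := by
    refine sqle ?_ (l2_nonneg _)
    rw [mul_pow, hf2]; exact (h4 _ ((l0_res _ _).trans hPc)).1
  have hΨv : l2 (Ψ.mulVec v) ≤ 2 * ε := by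
    have : Ψ.mulVec v = (u - Ψ.mulVec cbar) + (-z) := by
      rw [hv, hu, Matrix.mulVec_sub]; abel
    rw [this]
    refine (l2_add_le _ _).trans ?_
    rw [l2_neg]; linarith
  have hmain : f * Y ≤ 2 * ε + g * X := by
    have e : Ψ.mulVec (res P v) = Ψ.mulVec v + -(Ψ.mulVec (res (Tᶜ \ T1) v)) := by
      have e' : Ψ.mulVec v = Ψ.mulVec (res P v) + Ψ.mulVec (res (Tᶜ \ T1) v) := by
        rw [← Matrix.mulVec_add, ← hvsplit]
      rw [e']; abel
    have := l2_add_le (Ψ.mulVec v) (-(Ψ.mulVec (res (Tᶜ \ T1) v)))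
    rw [← e, l2_neg] at this
    linarith
  have hYb : (r * f - g) * Y ≤ 2 * ε * r := by
    have e1 := mul_le_mul_of_nonneg_left hmain (by linarith : 0 ≤ r)
    have e2 := mul_le_mul_of_nonneg_left hXY hg0
    linarith
  have hvsq : (l2 v)^2 = Y^2 + (l2 (res (Tᶜ \ T1) v))^2 := by
    rw [hY, l2_res_sq, l2_res_sq, l2_sq, hP, add_comm, Finset.sum_add_sum_compl]
  rw [hD, le_div_iff₀ hDpos]
  have hvY : r * l2 v ≤ Real.sqrt (1 + a) * Y := by
    refine sqle ?_ (by positivity)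
    rw [mul_pow, mul_pow, Real.sq_sqrt (by linarith), hvsq, ← haeq]
    have hc : (l2 (res (Tᶜ \ T1) v))^2 ≤ X^2 := pow_le_pow_left₀ (l2_nonneg _) hX1 2
    have hc2 : (r * X)^2 ≤ Y^2 := pow_le_pow_left₀ (by positivity) hXY 2
    rw [mul_pow, ← haeq] at hc2
    nlinarith
  have hA0 : 0 ≤ Real.sqrt (1 + a) := Real.sqrt_nonneg _
  have : r * (l2 v * (r * f - g)) ≤ r * (2 * ε * Real.sqrt (1 + a)) := by
    calc r * (l2 v * (r * f - g)) = (r * l2 v) * (r * f - g) := by ring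
      _ ≤ (Real.sqrt (1 + a) * Y) * (r * f - g) := by gcongr
      _ = Real.sqrt (1 + a) * ((r * f - g) * Y) := by ring
      _ ≤ Real.sqrt (1 + a) * (2 * ε * r) := by gcongr
      _ = _ := by ring
  exact le_of_mul_le_mul_left this (by linarith)
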